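/- Let G be a graph with an edge {a,b} whose endpoints lie in a common biconnected component B_{ab} of G, and suppose that in G − {a,b} (the graph with the edge {a,b} deleted) the vertices a and b lie in the same connected component but in no common biconnected component. Then the edge {a,b} belongs to a cycle component (S-node) of the triconnected decomposition of B_{ab}. -/

import Mathlib

open SimpleGraph

/-- The graph `G` with the edge `{a,b}` inserted. -/
def addEdge {W : Type*} (G : SimpleGraph W) (a b : W) : SimpleGraph W :=
  G ⊔ SimpleGraph.fromEdgeSet {s(a, b)}

/-- `u` and `v` are joined by a walk all of whose vertices lie in `A`,
i.e. they are connected in the subgraph induced on `A`. -/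
def ReachableWithin {W : Type*} (G : SimpleGraph W) (A : Set W) (u v : W) : Prop :=
  ∃ p : G.Walk u v, ∀ x ∈ p.support, x ∈ A

/-- The subgraph of `G` induced on the vertex set `A` is connected. -/
def ConnectedOn {W : Type*} (G : SimpleGraph W) (A : Set W) : Prop :=
  A.Nonempty ∧ ∀ ⦃u⦄, u ∈ A → ∀ ⦃v⦄, v ∈ A → ReachableWithin G A u v

/-- The subgraph of `G` induced on `A` is biconnected: connected and without cut vertices. -/
def BiconnectedOn {W : Type*} (G : SimpleGraph W) (A : Set W) : Prop :=
  ConnectedOn G A ∧ ∀ w ∈ A, (A \ {w}).Nonempty → ConnectedOn G (A \ {w})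

/-- `B` is (the vertex set of) a block of `G`: a maximal biconnected subgraph. -/
def IsBlock {W : Type*} (G : SimpleGraph W) (B : Set W) : Prop :=
  BiconnectedOn G B ∧ ∀ B' : Set W, B ⊆ B' → BiconnectedOn G B' → B' = B

/-- The subgraph of `G` induced on `A` is `k`-connected: it has more than `k` vertices
and remains connected after deleting any fewer than `k` vertices. -/
def KConnectedOn {W : Type*} (k : ℕ) (G : SimpleGraph W) (A : Set W) : Prop :=
  (∃ f : Fin (k + 1) → W, Function.Injective f ∧ ∀ i, f i ∈ A) ∧
  ∀ S : Set W, S.Finite → S.ncard < k → ConnectedOn G (A \ S)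

/-- `G` is `k`-connected. -/
def KConnected {W : Type*} (k : ℕ) (G : SimpleGraph W) : Prop :=
  KConnectedOn k G Set.univ

/-- Two walks with common endpoints are internally vertex-disjoint: they share no
vertices other than the endpoints. -/
def IntDisjoint {W : Type*} (G : SimpleGraph W) {s t : W} (p q : G.Walk s t) : Prop :=
  ∀ x, x ∈ p.support → x ∈ q.support → x = s ∨ x = t

/-- The subgraph of `G` induced on the vertex set `A` (with edges only inside `A`),
as a graph on the ambient vertex type. -/
def inducedOn {W : Type*} (G : SimpleGraph W) (A : Set W) : SimpleGraph W :=
  SimpleGraph.fromRel (fun u v => u ∈ A ∧ v ∈ A ∧ G.Adj u v)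

/-- There are three pairwise internally vertex-disjoint `s`–`t` paths
inside the vertex set `B`. -/
def ThreePathsOn {W : Type*} (G : SimpleGraph W) (B : Set W) (s t : W) : Prop :=
  ∃ p₁ p₂ p₃ : G.Walk s t,
    p₁.IsPath ∧ p₂.IsPath ∧ p₃.IsPath ∧
    (∀ x ∈ p₁.support, x ∈ B) ∧ (∀ x ∈ p₂.support, x ∈ B) ∧ (∀ x ∈ p₃.support, x ∈ B) ∧
    p₁ ≠ p₂ ∧ p₁ ≠ p₃ ∧ p₂ ≠ p₃ ∧
    IntDisjoint G p₁ p₂ ∧ IntDisjoint G p₁ p₃ ∧ IntDisjoint G p₂ p₃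

/-- `{s,t}` is a separating pair of (the subgraph induced on) `B`:
deleting both vertices disconnects it. -/
def SepPairOn {W : Type*} (G : SimpleGraph W) (B : Set W) (s t : W) : Prop :=
  s ∈ B ∧ t ∈ B ∧ s ≠ t ∧ (B \ {s, t}).Nonempty ∧ ¬ ConnectedOn G (B \ {s, t})

/-- `{s,t}` is a 3-connected separating pair of `B`: a separating pair whose two
vertices are joined by three internally vertex-disjoint paths. -/
def TriSepPairOn {W : Type*} (G : SimpleGraph W) (B : Set W) (s t : W) : Prop :=
  SepPairOn G B s t ∧ ThreePathsOn G B s t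

/-- Deleting the pair `{s,t}` separates `u` from `v` inside `B`. -/
def SeparatesOn {W : Type*} (G : SimpleGraph W) (B : Set W) (s t u v : W) : Prop :=
  u ∈ B \ {s, t} ∧ v ∈ B \ {s, t} ∧ ¬ ReachableWithin G (B \ {s, t}) u v

/-- `u` and `v` lie in a common triconnected component of `B`:
no 3-connected separating pair separates them. -/
def SameTriCompOn {W : Type*} (G : SimpleGraph W) (B : Set W) (u v : W) : Prop :=
  u ∈ B ∧ v ∈ B ∧ ∀ s t : W, TriSepPairOn G B s t → ¬ SeparatesOn G B s t u v

/-- `R` is (the vertex set of) a triconnected component of the block `B`. -/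
def IsTriCompOn {W : Type*} (G : SimpleGraph W) (B R : Set W) : Prop :=
  R ⊆ B ∧ R.Pairwise (SameTriCompOn G B) ∧
  ∀ R' : Set W, R ⊆ R' → R' ⊆ B → R'.Pairwise (SameTriCompOn G B) → R' = R

/-- The graph of the triconnected component on `R` of the block `B`: edges of `G`
inside `R` together with virtual edges for 3-connected separating pairs inside `R`. -/
def triCompGraph {W : Type*} (G : SimpleGraph W) (B R : Set W) : SimpleGraph W :=
  SimpleGraph.fromRel (fun u v => u ∈ R ∧ v ∈ R ∧ (G.Adj u v ∨ TriSepPairOn G B u v))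

/-- `R` is a rigid component (R-node): a triconnected component of `B` whose
component graph is 3-connected. -/
def IsRigidCompOn {W : Type*} (G : SimpleGraph W) (B R : Set W) : Prop :=
  IsTriCompOn G B R ∧ KConnectedOn 3 (triCompGraph G B R) R

/-- The restriction of the graph `H` to `R` is a cycle: connected, at least three
vertices, and every vertex has exactly two neighbours. -/
def IsCycleGraphOn {W : Type*} (H : SimpleGraph W) (R : Set W) : Prop :=
  ConnectedOn H R ∧ 3 ≤ R.ncard ∧ R.Finite ∧
  ∀ v ∈ R, ∃ x y : W, x ≠ y ∧ {z : W | H.Adj v z} = {x, y}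

/-- The path `R_a, P_1, R_1, …, R_k, P_(k+1), R_b` in the SPQR-tree `T_3(B)` of the
block `B`, between the rigid components `R 0 ∋ a` and `R (k+1) ∋ b`; `P i` is the
`i`-th 3-connected separating pair (P-node) on the path, adjacent to the rigid
components `R i` and `R (i+1)`. -/
structure SPQRPathOn {W : Type*} (G : SimpleGraph W) (B : Set W) (a b : W) (k : ℕ) where
  R : Fin (k + 2) → Set W
  P : Fin (k + 1) → W × W
  rigid : ∀ i, IsRigidCompOn G B (R i)
  sep : ∀ i, TriSepPairOn G B (P i).1 (P i).2
  ha : a ∈ R 0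
  hb : b ∈ R (Fin.last (k + 1))
  linkL : ∀ i : Fin (k + 1), (P i).1 ∈ R i.castSucc ∧ (P i).2 ∈ R i.castSucc
  linkR : ∀ i : Fin (k + 1), (P i).1 ∈ R i.succ ∧ (P i).2 ∈ R i.succ
  R_inj : Function.Injective R
  P_inj : Function.Injective P


namespace SN
variable {V : Type*}

theorem rw_refl {G : SimpleGraph V} {A : Set V} {u : V} (h : u ∈ A) : ReachableWithin G A u u :=
  ⟨Walk.nil, by simpa using h⟩

theorem rw_symm {G : SimpleGraph V} {A : Set V} {u v : V} (h : ReachableWithin G A u v) :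
    ReachableWithin G A v u := by
  obtain ⟨p, hp⟩ := h
  exact ⟨p.reverse, by simpa using hp⟩

theorem rw_trans {G : SimpleGraph V} {A : Set V} {u v w : V} (h : ReachableWithin G A u v)
    (h' : ReachableWithin G A v w) : ReachableWithin G A u w := by
  obtain ⟨p, hp⟩ := h
  obtain ⟨q, hq⟩ := h'
  refine ⟨p.append q, fun x hx => ?_⟩
  rcases Walk.mem_support_append_iff _ _ |>.1 hx with h | h
  · exact hp x h
  · exact hq x h

theorem rw_mono {G : SimpleGraph V} {A A' : Set V} {u v : V} (hA : A ⊆ A')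
    (h : ReachableWithin G A u v) : ReachableWithin G A' u v := by
  obtain ⟨p, hp⟩ := h
  exact ⟨p, fun x hx => hA (hp x hx)⟩

theorem rw_monoG {G G' : SimpleGraph V} {A : Set V} {u v : V} (hG : G ≤ G')
    (h : ReachableWithin G A u v) : ReachableWithin G' A u v := by
  obtain ⟨p, hp⟩ := h
  exact ⟨p.mapLe hG, by simpa using hp⟩

theorem rw_adj {G : SimpleGraph V} {A : Set V} {u v : V} (h : G.Adj u v) (hu : u ∈ A)
    (hv : v ∈ A) : ReachableWithin G A u v :=
  ⟨h.toWalk, by simp [hu, hv]⟩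

theorem rw_left {G : SimpleGraph V} {A : Set V} {u v : V} (h : ReachableWithin G A u v) :
    u ∈ A := by
  obtain ⟨p, hp⟩ := h
  exact hp _ p.start_mem_support

theorem rw_right {G : SimpleGraph V} {A : Set V} {u v : V} (h : ReachableWithin G A u v) :
    v ∈ A := by
  obtain ⟨p, hp⟩ := h
  exact hp _ p.end_mem_support

theorem rw_of_walk {G : SimpleGraph V} {u v : V} (p : G.Walk u v) {A : Set V}
    (h : ∀ x ∈ p.support, x ∈ A) : ReachableWithin G A u v := ⟨p, h⟩

theorem rw_path {G : SimpleGraph V} {A : Set V} {u v : V} (h : ReachableWithin G A u v) :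
    ∃ p : G.Walk u v, p.IsPath ∧ ∀ x ∈ p.support, x ∈ A := by
  classical
  obtain ⟨p, hp⟩ := h
  exact ⟨p.bypass, p.bypass_isPath, fun x hx => hp x (p.support_bypass_subset_support hx)⟩

/-- first step -/
theorem rw_first {G : SimpleGraph V} {A : Set V} {u v : V} (h : ReachableWithin G A u v)
    (hne : u ≠ v) : ∃ x ∈ A, G.Adj u x := by
  obtain ⟨p, hp⟩ := h
  cases p with
  | nil => exact absurd rfl hne
  | cons h q => exact ⟨_, hp _ (by simp), h⟩

/-- Splitting a path at a vertex. -/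
theorem split_path {G : SimpleGraph V} {u v c : V} (p : G.Walk u v) (hp : p.IsPath)
    (hc : c ∈ p.support) : ∃ (q : G.Walk u c) (r : G.Walk c v), q.IsPath ∧ r.IsPath ∧
      (∀ x ∈ q.support, x ∈ p.support) ∧ (∀ x ∈ r.support, x ∈ p.support) ∧
      (∀ x ∈ q.support, x ∈ r.support → x = c) ∧
      (∀ x ∈ p.support, x ∈ q.support ∨ x ∈ r.support) := by
  classical
  refine ⟨p.takeUntil c hc, p.dropUntil c hc, hp.takeUntil hc, hp.dropUntil hc,
    fun x hx => p.support_takeUntil_subset_support hc hx, fun x hx => p.support_dropUntil_subset_support hc hx, ?_, ?_⟩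
  · intro x hx hx'
    have h1 := hp.support_nodup
    rw [← p.take_spec hc, Walk.support_append, List.nodup_append] at h1
    rw [Walk.support_eq_cons] at hx'
    rcases List.mem_cons.1 hx' with h | h
    · exact h
    · exact absurd rfl (h1.2.2 x hx x h)
  · intro x hx
    rw [← p.take_spec hc] at hx
    exact (Walk.mem_support_append_iff _ _).1 hx

/-- First hit of a set. -/
theorem first_hit {G : SimpleGraph V} (X : Set V) {u t : V} (r : G.Walk u t) (ht : t ∈ X) :
    ∃ z ∈ X, z ∈ r.support ∧ ∃ q : G.Walk u z, (∀ x ∈ q.support, x ∈ r.support) ∧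
      ∀ x ∈ q.support, x ∈ X → x = z := by
  induction r with
  | nil => exact ⟨_, ht, by simp, Walk.nil, by simp, by simp⟩
  | @cons u w t h r ih =>
    by_cases hu : u ∈ X
    · exact ⟨u, hu, by simp, Walk.nil, by simp, by simp⟩
    · obtain ⟨z, hz, hzr, q, hq, hq'⟩ := ih ht
      refine ⟨z, hz, by simp [hzr], Walk.cons h q, ?_, ?_⟩
      · intro x hx
        rw [Walk.support_cons, List.mem_cons] at hx ⊢
        exact hx.imp id (hq x)
      · intro x hx hX
        rw [Walk.support_cons, List.mem_cons] at hx
        rcases hx with rfl | hx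
        · exact absurd hX hu
        · exact hq' x hx hX

/-- two internally disjoint walks from `c` to `v` inside `J` -/
def Good (N : SimpleGraph V) (J : Set V) (c v : V) : Prop :=
  ∃ p q : N.Walk c v, (∀ x ∈ p.support, x ∈ J) ∧ (∀ x ∈ q.support, x ∈ J) ∧ IntDisjoint N p q

theorem good_aux {N : SimpleGraph V} {J : Set V} {c v w : V} (hw : w ∈ J) (hvw : N.Adj v w)
    (p q : N.Walk c v) (hpp : p.IsPath) (hp : ∀ x ∈ p.support, x ∈ J)
    (hq : ∀ x ∈ q.support, x ∈ J) (hd : ∀ x ∈ p.support, x ∈ q.support → x = c ∨ x = v)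
    (z : V) (hz : z ∈ p.support) (hzv : z ≠ v) (r : N.Walk w z)
    (hr : ∀ x ∈ r.support, x ∈ J) (hr' : ∀ x ∈ r.support, x ∈ p.support ∨ x ∈ q.support → x = z) :
    Good N J c w := by
  obtain ⟨p1, p2, -, -, h1, h2, h3, h4⟩ := split_path p hpp hz
  refine ⟨p1.append r.reverse, q.concat hvw, ?_, ?_, ?_⟩
  · intro x hx
    rcases (Walk.mem_support_append_iff _ _).1 hx with h | h
    · exact hp x (h1 x h)
    · exact hr x (by simpa using h)
  · intro x hx
    rw [Walk.support_concat] at hx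
    simp only [List.concat_eq_append, List.mem_append, List.mem_singleton] at hx
    rcases hx with h | rfl
    · exact hq x h
    · exact hw
  · intro x hx hx'
    rw [Walk.support_concat] at hx'
    simp only [List.concat_eq_append, List.mem_append, List.mem_singleton] at hx'
    rcases hx' with hx' | h
    · rcases (Walk.mem_support_append_iff _ _).1 hx with h | h
      · rcases hd x (h1 x h) hx' with h' | h'
        · exact Or.inl h'
        · subst h'
          exact absurd (h3 x h p2.end_mem_support) hzv.symm
      · have := hr' x (by simpa using h) (Or.inr hx')
        subst this
        rcases hd x hz hx' with h' | h'
        · exact Or.inl h'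
        · exact absurd h' hzv
    · exact Or.inr h

theorem good_step {N : SimpleGraph V} {J : Set V} {c v w : V} (hvw : N.Adj v w)
    (hg : Good N J c v) (h : ReachableWithin N (J \ {v}) c w) : Good N J c w := by
  classical
  have hw : w ∈ J := (rw_right h).1
  obtain ⟨p0, q0, hp0, hq0, hd0⟩ := hg
  obtain ⟨p, hp, hpp, hps⟩ : ∃ p : N.Walk c v, (∀ x ∈ p.support, x ∈ J) ∧ p.IsPath ∧
      ∀ x ∈ p.support, x ∈ p0.support :=
    ⟨p0.bypass, fun x hx => hp0 x (p0.support_bypass_subset_support hx), p0.bypass_isPath,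
      fun x hx => p0.support_bypass_subset_support hx⟩
  obtain ⟨q, hq, hqp, hqs⟩ : ∃ p : N.Walk c v, (∀ x ∈ p.support, x ∈ J) ∧ p.IsPath ∧
      ∀ x ∈ p.support, x ∈ q0.support :=
    ⟨q0.bypass, fun x hx => hq0 x (q0.support_bypass_subset_support hx), q0.bypass_isPath,
      fun x hx => q0.support_bypass_subset_support hx⟩
  have hd : ∀ x ∈ p.support, x ∈ q.support → x = c ∨ x = v :=
    fun x h1 h2 => hd0 x (hps x h1) (hqs x h2)
  obtain ⟨r, hr⟩ := rw_symm h
  obtain ⟨z, hz, hzr, r', h1, h2⟩ := first_hit {x | x ∈ p.support ∨ x ∈ q.support} r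
    (Or.inl p.start_mem_support)
  have hzv : z ≠ v := (hr z hzr).2
  have hr' : ∀ x ∈ r'.support, x ∈ J := fun x hx => (hr x (h1 x hx)).1
  rcases hz with hz | hz
  · exact good_aux hw hvw p q hpp hp hq hd z hz hzv r' hr' h2
  · exact good_aux hw hvw q p hqp hq hp (fun x a b => hd x b a) z hz hzv r' hr'
      (fun x a b => h2 x a b.symm)

theorem good_walk {N : SimpleGraph V} {J : Set V} {c d : V}
    (hJ : ∀ x ∈ J, x ≠ c → x ≠ d → ReachableWithin N (J \ {x}) c d) {v : V} (r : N.Walk v d)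
    (hr : r.IsPath) (hrJ : ∀ x ∈ r.support, x ∈ J) (hc : c ∈ J) (hg : Good N J c v) :
    Good N J c d := by
  induction r with
  | nil => exact hg
  | @cons v w d h r ih =>
    rw [Walk.cons_isPath_iff] at hr
    have hrJ' : ∀ x ∈ r.support, x ∈ J := fun x hx => hrJ x (by simp [hx])
    refine ih hJ hr.1 hrJ' ?_
    have hw : w ∈ J := hrJ' _ r.start_mem_support
    by_cases hvc : v = c
    · subst hvc
      refine ⟨h.toWalk, h.toWalk, by simp [hc, hw], by simp [hc, hw], ?_⟩
      intro x hx _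
      simpa using hx
    · refine good_step h hg ?_
      have hvd : v ≠ d := fun e => hr.2 (e ▸ r.end_mem_support)
      refine rw_trans (hJ v (hrJ v (by simp)) hvc hvd) (rw_symm ⟨r, fun x hx => ⟨hrJ' x hx, ?_⟩⟩)
      rintro rfl
      exact hr.2 hx

theorem menger2 {N : SimpleGraph V} {J : Set V} {c d : V}
    (hJ : ∀ x ∈ J, x ≠ c → x ≠ d → ReachableWithin N (J \ {x}) c d)
    (h : ReachableWithin N J c d) : Good N J c d := by
  obtain ⟨r, hr, hrJ⟩ := rw_path h
  have hc := rw_left h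
  exact good_walk hJ r hr hrJ hc ⟨Walk.nil, Walk.nil, by simpa using hc, by simpa using hc,
    fun x hx _ => by simpa using hx⟩

/-- A path containing the edge between its endpoints is that edge. -/
theorem path_edge {G : SimpleGraph V} {s t : V} (p : G.Walk s t) (hp : p.IsPath)
    (h : s(s, t) ∈ p.edges) : ∃ e : G.Adj s t, p = e.toWalk := by
  cases p with
  | nil => simp at h
  | @cons _ x _ e q =>
    rw [Walk.cons_isPath_iff] at hp
    rw [Walk.edges_cons, List.mem_cons] at h
    rcases h with h | h
    · have : x = t := by
        rcases Sym2.eq_iff.1 h with h | h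
        · exact h.2.symm
        · rw [h.2, ← h.1]
      subst this
      have := Walk.isPath_iff_eq_nil.1 hp.1
      subst this
      exact ⟨e, rfl⟩
    · exact absurd (q.fst_mem_support_of_mem_edges h) hp.2

end SN

namespace SN
variable {V : Type*}

/-- The local situation inside the block `B`; `N` is `G` without the edge `ab`. -/
structure Ctx (G N : SimpleGraph V) (a b : V) (B : Set V) : Prop where
  ha : a ∈ B
  hb : b ∈ B
  hab : G.Adj a b
  NG : N ≤ G
  GN : ∀ u v, G.Adj u v → s(u, v) ≠ s(a, b) → N.Adj u v
  conn : ReachableWithin N B a b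
  side : ∀ w ∈ B, ∀ v ∈ B, v ≠ w →
    ReachableWithin N (B \ {w}) a v ∨ ReachableWithin N (B \ {w}) v b
  third : ∃ m ∈ B, m ≠ a ∧ m ≠ b ∧ ¬ ReachableWithin N (B \ {m}) a b

/-- vertices on all `a`-`b` walks -/
def SS (N : SimpleGraph V) (a b : V) (B : Set V) : Set V :=
  {c | c ∈ B ∧ ¬ ReachableWithin N (B \ {c}) a b}

/-- vertices on the `a`-side of `c` -/
def LL (N : SimpleGraph V) (a : V) (B : Set V) (c v : V) : Prop :=
  ReachableWithin N (B \ {c}) a v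

/-- vertices on the `b`-side of `c` -/
def UU (N : SimpleGraph V) (b : V) (B : Set V) (c v : V) : Prop :=
  ReachableWithin N (B \ {c}) v b

/-- vertices strictly between `c` and `d` -/
def II (N : SimpleGraph V) (a b : V) (B : Set V) (c d : V) : Set V :=
  {v | UU N b B c v ∧ LL N a B d v}

namespace Ctx
variable {G N : SimpleGraph V} {a b : V} {B : Set V}

theorem aS (h : Ctx G N a b B) : a ∈ SS N a b B := ⟨h.ha, fun k => (rw_left k).2 rfl⟩
theorem bS (h : Ctx G N a b B) : b ∈ SS N a b B := ⟨h.hb, fun k => (rw_right k).2 rfl⟩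

theorem excl {c v : V} (hc : c ∈ SS N a b B) (h1 : LL N a B c v) (h2 : UU N b B c v) : False :=
  hc.2 (rw_trans h1 h2)

theorem memS {c : V} (hc : c ∈ SS N a b B) {A : Set V} (hA : A ⊆ B) (p : N.Walk a b)
    (hp : ∀ x ∈ p.support, x ∈ A) : c ∈ p.support := by
  by_contra hn
  refine hc.2 ⟨p, fun x hx => ⟨hA (hp x hx), ?_⟩⟩
  rintro rfl
  exact hn hx

/-- The two possible orders of `c, d` on a path. -/
theorem order {c d : V} (hc : c ∈ SS N a b B) (hd : d ∈ SS N a b B) (hne : c ≠ d)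
    {A : Set V} (hA : A ⊆ B) (hr : ReachableWithin N A a b) :
    (LL N a B d c ∧ UU N b B c d ∧ ReachableWithin N (A ∩ (II N a b B c d ∪ {c, d})) c d) ∨
    (LL N a B c d ∧ UU N b B d c) := by
  obtain ⟨p, hp, hpA⟩ := rw_path hr
  have hpB : ∀ x ∈ p.support, x ∈ B := fun x hx => hA (hpA x hx)
  obtain ⟨q, r, hq, hr, hqp, hrp, hqr, hall⟩ := split_path p hp (memS hc hA p hpA)
  rcases hall d (memS hd hA p hpA) with h | h
  · right
    obtain ⟨q1, q2, hq1, hq2, hq1p, hq2p, hq12, -⟩ := split_path q hq h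
    constructor
    · refine ⟨q1, fun x hx => ⟨hpB x (hqp x (hq1p x hx)), ?_⟩⟩
      rintro rfl
      exact hne (hq12 _ hx q2.end_mem_support)
    · refine ⟨r, fun x hx => ⟨hpB x (hrp x hx), ?_⟩⟩
      rintro rfl
      exact hne (hqr _ h hx).symm
  · left
    obtain ⟨q1, q2, hq1, hq2, hq1p, hq2p, hq12, -⟩ := split_path r hr h
    have hdq : d ∉ q.support := fun k => hne (hqr _ k h).symm
    have hL : LL N a B d c := by
      refine ⟨q, fun x hx => ⟨hpB x (hqp x hx), ?_⟩⟩
      rintro rfl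
      exact hdq hx
    have hU : UU N b B c d := by
      refine ⟨q2, fun x hx => ⟨hpB x (hrp x (hq2p x hx)), ?_⟩⟩
      rintro rfl
      exact hne (hq12 _ q1.start_mem_support hx)
    refine ⟨hL, hU, q1, fun x hx => ⟨hpA x (hrp x (hq1p x hx)), ?_⟩⟩
    by_cases hxc : x = c
    · simp [hxc]
    by_cases hxd : x = d
    · simp [hxd]
    left
    obtain ⟨s1, s2, -, -, hs1p, hs2p, hs12, -⟩ := split_path q1 hq1 hx
    have e1 : ReachableWithin N (B \ {c}) x d := by
      refine ⟨s2, fun y hy => ⟨hpB y (hrp y (hq1p y (hs2p y hy))), ?_⟩⟩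
      rintro rfl
      exact hxc (hs12 _ s1.start_mem_support hy).symm
    have e2 : ReachableWithin N (B \ {d}) c x := by
      refine ⟨s1, fun y hy => ⟨hpB y (hrp y (hq1p y (hs1p y hy))), ?_⟩⟩
      rintro rfl
      exact hxd (hs12 _ hy s2.end_mem_support).symm
    exact ⟨rw_trans e1 hU, rw_trans hL e2⟩

theorem asymm (h : Ctx G N a b B) {c d : V} (hc : c ∈ SS N a b B) (hd : d ∈ SS N a b B)
    (hl : LL N a B d c) : ¬ LL N a B c d := by
  intro hl'
  have hne : c ≠ d := fun e => (rw_right hl).2 e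
  rcases order hc hd hne subset_rfl h.conn with ⟨-, h2, -⟩ | ⟨-, h2⟩
  · exact excl hc hl' h2
  · exact excl hd hl h2

theorem LtoU (h : Ctx G N a b B) {c d : V} (hc : c ∈ SS N a b B) (hd : d ∈ SS N a b B)
    (hl : LL N a B d c) : UU N b B c d := by
  have hne : c ≠ d := fun e => (rw_right hl).2 e
  rcases order hc hd hne subset_rfl h.conn with ⟨-, h2, -⟩ | ⟨-, h2⟩
  · exact h2
  · exact (excl hd hl h2).elim

theorem mid (h : Ctx G N a b B) {c d : V} (hc : c ∈ SS N a b B) (hd : d ∈ SS N a b B)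
    (hl : LL N a B d c) {A : Set V} (hA : A ⊆ B) (hr : ReachableWithin N A a b) :
    ReachableWithin N (A ∩ (II N a b B c d ∪ {c, d})) c d := by
  have hne : c ≠ d := fun e => (rw_right hl).2 e
  rcases order hc hd hne hA hr with ⟨-, -, h2⟩ | ⟨-, h2⟩
  · exact h2
  · exact (excl hd hl h2).elim

theorem monoL (h : Ctx G N a b B) {c d v : V} (hc : c ∈ SS N a b B) (hd : d ∈ SS N a b B)
    (hl : LL N a B d c) (hv : LL N a B c v) : LL N a B d v := by
  obtain ⟨p, hp, hpA⟩ := rw_path hv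
  refine ⟨p, fun x hx => ⟨(hpA x hx).1, ?_⟩⟩
  rintro rfl
  obtain ⟨q, r, -, -, hqp, -⟩ := split_path p hp hx
  exact h.asymm hc hd hl ⟨q, fun y hy => hpA y (hqp y hy)⟩

theorem monoU (h : Ctx G N a b B) {c d v : V} (hc : c ∈ SS N a b B) (hd : d ∈ SS N a b B)
    (hl : LL N a B d c) (hv : UU N b B d v) : UU N b B c v := by
  obtain ⟨p, hp, hpA⟩ := rw_path hv
  refine ⟨p, fun x hx => ⟨(hpA x hx).1, ?_⟩⟩
  rintro rfl
  obtain ⟨q, r, -, -, -, hrp, -⟩ := split_path p hp hx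
  exact excl hd hl ⟨r, fun y hy => hpA y (hrp y hy)⟩

/-- rank function -/
theorem exists_rank [Finite V] (h : Ctx G N a b B) : ∃ f : V → ℕ,
    (∀ c ∈ SS N a b B, ∀ d ∈ SS N a b B, f c < f d → LL N a B d c) ∧
    (∀ c ∈ SS N a b B, ∀ d ∈ SS N a b B, f c = f d → c = d) := by
  have key : ∀ c ∈ SS N a b B, ∀ d ∈ SS N a b B, LL N a B d c →
      Set.ncard {x | LL N a B c x} < Set.ncard {x | LL N a B d x} := by
    intro c hc d hd hl
    refine Set.ncard_lt_ncard ⟨fun x hx => h.monoL hc hd hl hx, fun hs => ?_⟩ (Set.toFinite _)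
    exact (rw_right (hs hl : LL N a B c c)).2 rfl
  refine ⟨fun v => Set.ncard {x | LL N a B v x}, ?_, ?_⟩
  · intro c hc d hd hlt
    have hne : c ≠ d := by rintro rfl; exact lt_irrefl _ hlt
    rcases order hc hd hne subset_rfl h.conn with ⟨h2, -⟩ | ⟨h2, -⟩
    · exact h2
    · exact absurd hlt (key d hd c hc h2).not_gt
  · intro c hc d hd heq
    by_contra hne
    rcases order hc hd hne subset_rfl h.conn with ⟨h2, -⟩ | ⟨h2, -⟩
    · exact absurd heq (key c hc d hd h2).ne
    · exact absurd heq (key d hd c hc h2).ne'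

theorem toA (h : Ctx G N a b B) {c : V} (hc : c ∈ SS N a b B) :
    ReachableWithin N ({v | LL N a B c v} ∪ {c}) c a := by
  obtain ⟨p, hp, hpB⟩ := rw_path h.conn
  obtain ⟨q, r, hq, hr, hqp, hrp, hqr, -⟩ := split_path p hp (memS hc subset_rfl p hpB)
  refine rw_symm ⟨q, fun x hx => ?_⟩
  by_cases hxc : x = c
  · right; exact hxc
  left
  obtain ⟨s, t, -, -, hsq, -, hst, -⟩ := split_path q hq hx
  refine ⟨s, fun y hy => ⟨hpB _ (hqp _ (hsq _ hy)), ?_⟩⟩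
  rintro rfl
  exact hxc (hst _ hy t.end_mem_support).symm

theorem toB (h : Ctx G N a b B) {c : V} (hc : c ∈ SS N a b B) :
    ReachableWithin N ({v | UU N b B c v} ∪ {c}) b c := by
  obtain ⟨p, hp, hpB⟩ := rw_path h.conn
  obtain ⟨q, r, hq, hr, hqp, hrp, hqr, -⟩ := split_path p hp (memS hc subset_rfl p hpB)
  refine rw_symm ⟨r, fun x hx => ?_⟩
  by_cases hxc : x = c
  · right; exact hxc
  left
  obtain ⟨s, t, -, -, -, htr, hst, -⟩ := split_path r hr hx
  refine ⟨t, fun y hy => ⟨hpB _ (hrp _ (htr _ hy)), ?_⟩⟩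
  rintro rfl
  exact hxc (hst _ s.start_mem_support hy).symm

theorem aNotI (h : Ctx G N a b B) {c d : V} (hc : c ∈ SS N a b B) : a ∉ II N a b B c d := by
  rintro ⟨h1, -⟩
  exact excl hc (rw_refl (rw_left h1)) h1

theorem bNotI (h : Ctx G N a b B) {c d : V} (hd : d ∈ SS N a b B) : b ∉ II N a b B c d := by
  rintro ⟨-, h1⟩
  exact excl hd h1 (rw_refl (rw_right h1))

theorem I_sub_B {c d : V} : II N a b B c d ⊆ B := fun _ hx => (rw_left hx.1).1

/-- from inside to the upper end -/
theorem I_to_d {c d v : V} (hd : d ∈ SS N a b B) (hv : v ∈ II N a b B c d) :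
    ReachableWithin N (II N a b B c d ∪ {d}) v d := by
  obtain ⟨p, hp, hpA⟩ := rw_path hv.1
  have hdp : d ∈ p.support := by
    by_contra hn
    refine excl hd hv.2 ⟨p, fun x hx => ⟨(hpA x hx).1, ?_⟩⟩
    rintro rfl
    exact hn hx
  obtain ⟨q, r, hq, -, hqp, hrp, hqr, -⟩ := split_path p hp hdp
  refine ⟨q, fun x hx => ?_⟩
  by_cases hxd : x = d
  · right; exact hxd
  left
  obtain ⟨s, t, -, -, hsq, htq, hst, -⟩ := split_path q hq hx
  refine ⟨rw_trans (v := d) ⟨t, fun y hy => hpA _ (hqp _ (htq _ hy))⟩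
    ⟨r, fun y hy => hpA _ (hrp _ hy)⟩, rw_trans hv.2
    ⟨s, fun y hy => ⟨(hpA _ (hqp _ (hsq _ hy))).1, ?_⟩⟩⟩
  rintro rfl
  exact hxd (hst _ hy t.end_mem_support).symm

/-- from the lower end to inside -/
theorem c_to_I {c d v : V} (hc : c ∈ SS N a b B) (hv : v ∈ II N a b B c d) :
    ReachableWithin N (II N a b B c d ∪ {c}) c v := by
  obtain ⟨p, hp, hpA⟩ := rw_path hv.2
  have hcp : c ∈ p.support := by
    by_contra hn
    refine excl hc ⟨p, fun x hx => ⟨(hpA x hx).1, ?_⟩⟩ hv.1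
    rintro rfl
    exact hn hx
  obtain ⟨q, r, -, hr, hqp, hrp, hqr, -⟩ := split_path p hp hcp
  refine ⟨r, fun x hx => ?_⟩
  by_cases hxd : x = c
  · right; exact hxd
  left
  obtain ⟨s, t, -, -, hsq, htq, hst, -⟩ := split_path r hr hx
  refine ⟨rw_trans ⟨t, fun y hy => ⟨(hpA _ (hrp _ (htq _ hy))).1, ?_⟩⟩ hv.1,
    rw_trans (v := c) ⟨q, fun y hy => hpA _ (hqp _ hy)⟩
    ⟨s, fun y hy => hpA _ (hrp _ (hsq _ hy))⟩⟩
  rintro rfl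
  exact hxd (hst _ s.start_mem_support hy).symm

/-- `{c,d}` separates the inside from everything else. -/
theorem sep (h : Ctx G N a b B) {c d : V} (hc : c ∈ SS N a b B) (hd : d ∈ SS N a b B)
    {v e : V} (hv : v ∈ II N a b B c d) (he : e ∉ II N a b B c d) :
    ¬ ReachableWithin G (B \ {c, d}) v e := by
  rintro ⟨p, hp⟩
  induction p with
  | nil => exact he hv
  | @cons u w x huw p ih =>
    refine ih ?_ he (fun y hy => hp y (by simp [hy]))
    have hw := hp w (by simp)
    have hwc : w ≠ c := fun e => hw.2 (by simp [e])
    have hwd : w ≠ d := fun e => hw.2 (by simp [e])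
    have hN : N.Adj u w := by
      refine h.GN u w huw fun hs => ?_
      rcases Sym2.eq_iff.1 hs with k | k
      · exact h.aNotI hc (k.1 ▸ hv)
      · exact h.bNotI hd (k.1 ▸ hv)
    exact ⟨rw_trans (rw_adj hN.symm ⟨hw.1, hwc⟩ (rw_left hv.1)) hv.1,
      rw_trans hv.2 (rw_adj hN (rw_right hv.2) ⟨hw.1, hwd⟩)⟩

theorem walk_alt (h : Ctx G N a b B) {c s t : V} (hc : c ∈ SS N a b B)
    (hst : (LL N a B c s ∧ UU N b B c t) ∨ (LL N a B c t ∧ UU N b B c s))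
    (p : G.Walk s t) (hp : ∀ x ∈ p.support, x ∈ B) : c ∈ p.support ∨ s(a, b) ∈ p.edges := by
  by_contra! hn
  have hr : ReachableWithin N (B \ {c}) s t := by
    refine ⟨p.transfer N ?_, ?_⟩
    · intro e he
      induction e with
      | _ u v =>
        exact h.GN u v (p.adj_of_mem_edges he) fun e => hn.2 (e ▸ he)
    · intro x hx
      rw [Walk.support_transfer] at hx
      refine ⟨hp x hx, ?_⟩
      rintro rfl
      exact hn.1 hx
  rcases hst with ⟨h1, h2⟩ | ⟨h1, h2⟩
  · exact excl hc h1 (rw_trans hr h2)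
  · exact excl hc h1 (rw_trans (rw_symm hr) h2)

/-- Claim A. -/
theorem claimA (h : Ctx G N a b B) {c s t : V} (hc : c ∈ SS N a b B)
    (hst : (LL N a B c s ∧ UU N b B c t) ∨ (LL N a B c t ∧ UU N b B c s))
    (h3 : ThreePathsOn G B s t) : False := by
  have hcs : c ≠ s := by
    rcases hst with ⟨h1, h2⟩ | ⟨h1, h2⟩
    · exact fun e => (rw_right h1).2 e.symm
    · exact fun e => (rw_left h2).2 e.symm
  have hct : c ≠ t := by
    rcases hst with ⟨h1, h2⟩ | ⟨h1, h2⟩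
    · exact fun e => (rw_left h2).2 e.symm
    · exact fun e => (rw_right h1).2 e.symm
  have two_c : ∀ p q : G.Walk s t, IntDisjoint G p q → c ∈ p.support → c ∈ q.support → False := by
    intro p q hd hp hq
    rcases hd c hp hq with e | e
    · exact hcs e
    · exact hct e
  have two_e : ∀ p q : G.Walk s t, p.IsPath → q.IsPath → p ≠ q → IntDisjoint G p q →
      s(a, b) ∈ p.edges → s(a, b) ∈ q.edges → False := by
    intro p q hp hq hne hd ep eq
    have hne' := h.hab.ne
    have e : s(a, b) = s(s, t) := by
      have h1 := hd a (p.fst_mem_support_of_mem_edges ep) (q.fst_mem_support_of_mem_edges eq)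
      have h2 := hd b (p.snd_mem_support_of_mem_edges ep) (q.snd_mem_support_of_mem_edges eq)
      rw [Sym2.eq_iff]
      grind
    rw [e] at ep eq
    obtain ⟨_, h1⟩ := path_edge p hp ep
    obtain ⟨_, h2⟩ := path_edge q hq eq
    exact hne (h1.trans h2.symm)
  obtain ⟨p₁, p₂, p₃, i1, i2, i3, b1, b2, b3, n12, n13, n23, d12, d13, d23⟩ := h3
  have k1 := h.walk_alt hc hst p₁ b1
  have k2 := h.walk_alt hc hst p₂ b2
  have k3 := h.walk_alt hc hst p₃ b3
  have c12 := two_c _ _ d12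
  have c13 := two_c _ _ d13
  have c23 := two_c _ _ d23
  have e12 := two_e _ _ i1 i2 n12 d12
  have e13 := two_e _ _ i1 i3 n13 d13
  have e23 := two_e _ _ i2 i3 n23 d23
  rcases k1 with k1 | k1 <;> rcases k2 with k2 | k2
  · exact c12 k1 k2
  · rcases k3 with k3 | k3
    · exact c13 k1 k3
    · exact e23 k2 k3
  · rcases k3 with k3 | k3
    · exact c23 k2 k3
    · exact e13 k1 k3
  · exact e12 k1 k2

/-- Two walks through the inside -/
theorem two_paths (h : Ctx G N a b B) {c d : V} (hc : c ∈ SS N a b B) (hd : d ∈ SS N a b B)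
    (hl : LL N a B d c) (hI : (II N a b B c d).Nonempty)
    (hcons : ∀ x ∈ II N a b B c d, x ∉ SS N a b B) :
    ∃ p q : N.Walk c d, p.IsPath ∧ q.IsPath ∧ p ≠ q ∧ IntDisjoint N p q ∧
      (∀ x ∈ p.support, x ∈ II N a b B c d ∪ {c, d}) ∧
      (∀ x ∈ q.support, x ∈ II N a b B c d ∪ {c, d}) := by
  classical
  have hne : c ≠ d := fun e => (rw_right hl).2 e
  have hcI : c ∉ II N a b B c d := fun k => (rw_left k.1).2 rfl
  have hdI : d ∉ II N a b B c d := fun k => (rw_right k.2).2 rfl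
  by_cases hadj : N.Adj c d
  · obtain ⟨v, hv⟩ := hI
    have hcv : c ≠ v := fun e => hcI (e ▸ hv)
    obtain ⟨x, hx, hcx⟩ := rw_first (c_to_I hc hv) hcv
    have hxI : x ∈ II N a b B c d := by
      rcases hx with hx | hx
      · exact hx
      · exact absurd hx hcx.ne'
    obtain ⟨r, hr, hrI⟩ := rw_path (I_to_d hd hxI)
    have hcr : c ∉ r.support := by
      intro k
      rcases hrI c k with k | k
      · exact hcI k
      · exact hne k
    refine ⟨hadj.toWalk, Walk.cons hcx r, ?_, ?_, ?_, ?_, ?_, ?_⟩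
    · simp [hne]
    · rw [Walk.cons_isPath_iff]; exact ⟨hr, hcr⟩
    · intro e
      have : x ∈ (hadj.toWalk).support := by rw [e]; simp
      simp only [Walk.support_cons, Walk.support_nil, List.mem_cons, List.not_mem_nil, or_false] at this
      rcases this with e | e
      · exact hcI (e ▸ hxI)
      · exact hdI (e ▸ hxI)
    · intro y hy _
      simpa using hy
    · intro y hy
      right
      simpa using hy
    · intro y hy
      rw [Walk.support_cons, List.mem_cons] at hy
      rcases hy with rfl | hy
      · simp
      · rcases hrI y hy with k | k
        · exact Or.inl k
        · right; right; exact k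
  · have hJB : II N a b B c d ∪ {c, d} ⊆ B := by
      rintro x (hx | rfl | rfl)
      · exact I_sub_B hx
      · exact hc.1
      · exact hd.1
    have hg : Good N (II N a b B c d ∪ {c, d}) c d := by
      refine menger2 ?_ (rw_mono Set.inter_subset_right (h.mid hc hd hl subset_rfl h.conn))
      intro x hx hxc hxd
      have hxI : x ∈ II N a b B c d := by
        rcases hx with hx | hx | hx
        · exact hx
        · exact absurd hx hxc
        · exact absurd hx hxd
      have hxr : ReachableWithin N (B \ {x}) a b := by
        by_contra hn
        exact hcons x hxI ⟨I_sub_B hxI, hn⟩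
      refine rw_mono ?_ (h.mid hc hd hl Set.sdiff_subset hxr)
      exact fun y hy => ⟨hy.2, hy.1.2⟩
    obtain ⟨p, q, hp, hq, hpq⟩ := hg
    refine ⟨p.bypass, q.bypass, p.bypass_isPath, q.bypass_isPath, ?_, ?_, ?_, ?_⟩
    · intro e
      have : ∀ x ∈ p.bypass.support, x = c ∨ x = d := by
        intro x hx
        exact hpq x (p.support_bypass_subset_support hx)
          (q.support_bypass_subset_support (e ▸ hx))
      obtain ⟨x, hx, hcx⟩ := rw_first (A := {c, d}) ⟨p.bypass, this⟩ hne
      rcases hx with rfl | hx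
      · exact hcx.ne rfl
      · rw [Set.mem_singleton_iff] at hx
        exact hadj (hx ▸ hcx)
    · exact fun x hx hx' => hpq x (p.support_bypass_subset_support hx)
          (q.support_bypass_subset_support hx')
    · exact fun x hx => hp x (p.support_bypass_subset_support hx)
    · exact fun x hx => hq x (q.support_bypass_subset_support hx)

/-- the path around -/
theorem around (h : Ctx G N a b B) {c d : V} (hc : c ∈ SS N a b B) (hd : d ∈ SS N a b B)
    (hl : LL N a B d c) : ∃ p : G.Walk c d, p.IsPath ∧ a ∈ p.support ∧ b ∈ p.support ∧
      ∀ x ∈ p.support, (LL N a B c x ∨ x = c) ∨ (UU N b B d x ∨ x = d) := by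
  obtain ⟨p, hp, hpA⟩ := rw_path (rw_monoG h.NG (h.toA hc))
  obtain ⟨q, hq, hqA⟩ := rw_path (rw_monoG h.NG (h.toB hd))
  have hne : c ≠ d := fun e => (rw_right hl).2 e
  have hs : (p.append (Walk.cons h.hab q)).support = p.support ++ q.support := by
    rw [Walk.support_append]; simp
  refine ⟨p.append (Walk.cons h.hab q), ?_, ?_, ?_, ?_⟩
  · rw [Walk.isPath_def, hs, List.nodup_append]
    refine ⟨hp.support_nodup, hq.support_nodup, ?_⟩
    rintro x hx y hy rfl
    rcases hpA x hx with k | k <;> rcases hqA x hy with k' | k'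
    · exact excl hd (h.monoL hc hd hl k) k'
    · rw [Set.mem_singleton_iff] at k'
      subst k'
      exact h.asymm hc hd hl k
    · rw [Set.mem_singleton_iff] at k
      subst k
      exact excl hd hl k'
    · exact hne (k.symm.trans k')
  · rw [hs]; simp
  · rw [hs]; simp
  · intro x hx
    rw [hs, List.mem_append] at hx
    rcases hx with hx | hx
    · exact Or.inl (hpA x hx)
    · exact Or.inr (hqA x hx)

/-- Consecutive elements with nonempty inside form a 3-connected separating pair. -/
theorem triSep (h : Ctx G N a b B) {c d : V} (hc : c ∈ SS N a b B) (hd : d ∈ SS N a b B)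
    (hl : LL N a B d c) (hI : (II N a b B c d).Nonempty)
    (hcons : ∀ x ∈ II N a b B c d, x ∉ SS N a b B)
    (h3 : ∃ e ∈ SS N a b B, e ≠ c ∧ e ≠ d) : TriSepPairOn G B c d := by
  classical
  have hne : c ≠ d := fun e => (rw_right hl).2 e
  have hcI : c ∉ II N a b B c d := fun k => (rw_left k.1).2 rfl
  have hdI : d ∉ II N a b B c d := fun k => (rw_right k.2).2 rfl
  obtain ⟨e, he, hec, hed⟩ := h3
  have heI : e ∉ II N a b B c d := fun k => hcons e k he
  refine ⟨⟨hc.1, hd.1, hne, ⟨e, he.1, by simp [hec, hed]⟩, ?_⟩, ?_⟩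
  · obtain ⟨v, hv⟩ := hI
    intro hcon
    have hvc : v ≠ c := fun k => hcI (k ▸ hv)
    have hvd : v ≠ d := fun k => hdI (k ▸ hv)
    exact h.sep hc hd hv heI (hcon.2 ⟨I_sub_B hv, by simp [hvc, hvd]⟩ ⟨he.1, by simp [hec, hed]⟩)
  · obtain ⟨p, q, hp, hq, hpq, hdis, hpI, hqI⟩ := h.two_paths hc hd hl hI hcons
    obtain ⟨r, hr, har, hbr, hrA⟩ := h.around hc hd hl
    have hJB : II N a b B c d ∪ {c, d} ⊆ B := by
      rintro x (hx | rfl | rfl)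
      · exact I_sub_B hx
      · exact hc.1
      · exact hd.1
    have hrI : ∀ x ∈ r.support, x ∈ II N a b B c d ∪ {c, d} → x = c ∨ x = d := by
      intro x hx hxI
      rcases hxI with hxI | hxI
      · rcases hrA x hx with (k | k) | (k | k)
        · exact (excl hc k hxI.1).elim
        · exact Or.inl k
        · exact (excl hd hxI.2 k).elim
        · exact Or.inr k
      · exact hxI
    have hnot : ¬ (∀ x ∈ r.support, x ∈ II N a b B c d ∪ {c, d}) := by
      intro hall
      have ka := hrI a har (hall a har)
      have kb := hrI b hbr (hall b hbr)
      have hab := h.hab.ne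
      -- `{a,b} = {c,d}`, so `e` would be inside
      have hcd : c = a ∧ d = b := by
        rcases ka with ka | ka
        · exact ⟨ka.symm, by grind⟩
        · exact absurd rfl (fun _ : a = a => (rw_left hl).2 ka)
      obtain ⟨rfl, rfl⟩ := hcd
      apply heI
      constructor
      · rcases h.side c hc.1 e he.1 hec with k | k
        · exact absurd rfl (rw_left k).2
        · exact k
      · rcases h.side d hd.1 e he.1 hed with k | k
        · exact k
        · exact absurd rfl (rw_right k).2
    have hrB : ∀ x ∈ r.support, x ∈ B := by
      intro x hx
      rcases hrA x hx with (k | k) | (k | k)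
      · exact (rw_right k).1
      · exact k ▸ hc.1
      · exact (rw_left k).1
      · exact k ▸ hd.1
    refine ⟨r, p.mapLe h.NG, q.mapLe h.NG, hr, by simpa using hp, by simpa using hq, hrB,
      fun x hx => hJB (hpI x (by simpa using hx)), fun x hx => hJB (hqI x (by simpa using hx)),
      ?_, ?_, ?_, ?_, ?_, ?_⟩
    · intro k
      exact hnot fun x hx => hpI x (by rw [k] at hx; simpa using hx)
    · intro k
      exact hnot fun x hx => hqI x (by rw [k] at hx; simpa using hx)
    · intro k
      exact hpq (Walk.map_injective_of_injective Function.injective_id _ _ k)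
    · exact fun x hx hx' => hrI x hx (hpI x (by simpa using hx'))
    · exact fun x hx hx' => hrI x hx (hqI x (by simpa using hx'))
    · exact fun x hx hx' => hdis x (by simpa using hx) (by simpa using hx')

end Ctx
end SN

namespace SN
variable {V : Type*}
namespace Ctx
variable {G N : SimpleGraph V} {a b : V} {B : Set V}

/-- No 3-connected separating pair separates two elements of `SS`. -/
theorem noSep_aux (h : Ctx G N a b B) {u v s t : V} (hu : u ∈ SS N a b B) (hv : v ∈ SS N a b B)
    (hl : LL N a B v u) (ht : ThreePathsOn G B s t) : ¬ SeparatesOn G B s t u v := by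
  rintro ⟨h1, h2, h3⟩
  have hU := h.LtoU hu hv hl
  have hus : u ≠ s := fun e => h1.2 (by simp [e])
  have hut : u ≠ t := fun e => h1.2 (by simp [e])
  have hvs : v ≠ s := fun e => h2.2 (by simp [e])
  have hvt : v ≠ t := fun e => h2.2 (by simp [e])
  -- one of the pair is inside
  have in1 : s ∈ II N a b B u v ∨ t ∈ II N a b B u v := by
    by_contra! hn
    apply h3
    refine rw_monoG h.NG (rw_mono ?_ (h.mid hu hv hl subset_rfl h.conn))
    rintro x ⟨hxB, hx⟩
    refine ⟨hxB, ?_⟩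
    rintro (rfl | rfl)
    · rcases hx with hx | rfl | rfl
      · exact hn.1 hx
      · exact hus rfl
      · exact hvs rfl
    · rcases hx with hx | rfl | rfl
      · exact hn.2 hx
      · exact hut rfl
      · exact hvt rfl
  have out1 : (LL N a B u s ∨ UU N b B v s) ∨ (LL N a B u t ∨ UU N b B v t) := by
    by_contra! hn
    apply h3
    obtain ⟨p, -, -, -, hp⟩ := h.around hu hv hl
    refine ⟨p, fun x hx => ⟨?_, ?_⟩⟩
    · rcases hp x hx with (k | k) | (k | k)
      · exact (rw_right k).1
      · exact k ▸ hu.1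
      · exact (rw_left k).1
      · exact k ▸ hv.1
    · rintro (rfl | rfl)
      · rcases hp x hx with (k | k) | (k | k)
        · exact hn.1.1 k
        · exact hus k.symm
        · exact hn.1.2 k
        · exact hvs k.symm
      · rcases hp x hx with (k | k) | (k | k)
        · exact hn.2.1 k
        · exact hut k.symm
        · exact hn.2.2 k
        · exact hvt k.symm
  rcases in1 with ⟨i1, i2⟩ | ⟨i1, i2⟩
  · rcases out1 with (o | o) | (o | o)
    · exact excl hu o i1
    · exact excl hv i2 o
    · exact h.claimA hu (Or.inr ⟨o, i1⟩) ht
    · exact h.claimA hv (Or.inl ⟨i2, o⟩) ht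
  · rcases out1 with (o | o) | (o | o)
    · exact h.claimA hu (Or.inl ⟨o, i1⟩) ht
    · exact h.claimA hv (Or.inr ⟨i2, o⟩) ht
    · exact excl hu o i1
    · exact excl hv i2 o

theorem noSep (h : Ctx G N a b B) {u v s t : V} (hu : u ∈ SS N a b B) (hv : v ∈ SS N a b B)
    (hne : u ≠ v) (ht : ThreePathsOn G B s t) : ¬ SeparatesOn G B s t u v := by
  rcases order hu hv hne subset_rfl h.conn with ⟨hl, -⟩ | ⟨hl, -⟩
  · exact h.noSep_aux hu hv hl ht
  · intro k
    exact h.noSep_aux hv hu hl ht ⟨k.2.1, k.1, fun r => k.2.2 (rw_symm r)⟩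

theorem triAdj {R : Set V} {u v : V} : (triCompGraph G B R).Adj u v ↔
    u ≠ v ∧ u ∈ R ∧ v ∈ R ∧ (G.Adj u v ∨ TriSepPairOn G B u v ∨ TriSepPairOn G B v u) := by
  rw [triCompGraph, SimpleGraph.fromRel_adj]
  have := G.adj_comm u v
  tauto

/-- consecutive elements -/
def Cons (N : SimpleGraph V) (a b : V) (B : Set V) (f : V → ℕ) (c d : V) : Prop :=
  c ∈ SS N a b B ∧ d ∈ SS N a b B ∧ f c < f d ∧
    ∀ e ∈ SS N a b B, f c < f e → f e < f d → False

variable {f : V → ℕ}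

theorem a_min (h : Ctx G N a b B)
    (f1 : ∀ c ∈ SS N a b B, ∀ d ∈ SS N a b B, f c < f d → LL N a B d c)
    (f2 : ∀ c ∈ SS N a b B, ∀ d ∈ SS N a b B, f c = f d → c = d)
    {e : V} (he : e ∈ SS N a b B) (hne : e ≠ a) : f a < f e := by
  rcases lt_trichotomy (f a) (f e) with k | k | k
  · exact k
  · exact absurd (f2 _ h.aS _ he k).symm hne
  · exact absurd rfl (rw_left (f1 _ he _ h.aS k)).2

theorem b_max (h : Ctx G N a b B)
    (f1 : ∀ c ∈ SS N a b B, ∀ d ∈ SS N a b B, f c < f d → LL N a B d c)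
    (f2 : ∀ c ∈ SS N a b B, ∀ d ∈ SS N a b B, f c = f d → c = d)
    {e : V} (he : e ∈ SS N a b B) (hne : e ≠ b) : f e < f b := by
  rcases lt_trichotomy (f e) (f b) with k | k | k
  · exact k
  · exact absurd (f2 _ he _ h.bS k) hne
  · exact absurd rfl (rw_right (h.LtoU h.bS he (f1 _ h.bS _ he k))).2

theorem cons_inside (h : Ctx G N a b B)
    (f1 : ∀ c ∈ SS N a b B, ∀ d ∈ SS N a b B, f c < f d → LL N a B d c)
    (f2 : ∀ c ∈ SS N a b B, ∀ d ∈ SS N a b B, f c = f d → c = d)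
    {c d : V} (hcd : Cons N a b B f c d) : ∀ x ∈ II N a b B c d, x ∉ SS N a b B := by
  obtain ⟨hc, hd, hlt, hbt⟩ := hcd
  intro x hx hxS
  refine hbt x hxS ?_ ?_
  · rcases lt_trichotomy (f c) (f x) with k | k | k
    · exact k
    · exact absurd (f2 _ hc _ hxS k).symm (rw_left hx.1).2
    · exact (excl hc (f1 _ hxS _ hc k) hx.1).elim
  · rcases lt_trichotomy (f x) (f d) with k | k | k
    · exact k
    · exact absurd (f2 _ hxS _ hd k) (rw_right hx.2).2
    · exact (excl hd hx.2 (h.LtoU hd hxS (f1 _ hd _ hxS k))).elim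

theorem cons_third (h : Ctx G N a b B)
    (f1 : ∀ c ∈ SS N a b B, ∀ d ∈ SS N a b B, f c < f d → LL N a B d c)
    (f2 : ∀ c ∈ SS N a b B, ∀ d ∈ SS N a b B, f c = f d → c = d)
    {c d : V} (hcd : Cons N a b B f c d) : ∃ e ∈ SS N a b B, e ≠ c ∧ e ≠ d := by
  obtain ⟨hc, hd, hlt, hbt⟩ := hcd
  obtain ⟨m, hmB, hma, hmb, hmS⟩ := h.third
  have hm : m ∈ SS N a b B := ⟨hmB, hmS⟩
  by_cases hca : c = a
  · by_cases hdb : d = b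
    · subst hca hdb
      exact (hbt m hm (h.a_min f1 f2 hm hma) (h.b_max f1 f2 hm hmb)).elim
    · exact ⟨b, h.bS, by rw [hca]; exact h.hab.ne', fun e => hdb e.symm⟩
  · refine ⟨a, h.aS, fun e => hca e.symm, ?_⟩
    rintro rfl
    exact absurd hlt (h.a_min f1 f2 hc hca).not_gt

theorem cons_adj (h : Ctx G N a b B)
    (f1 : ∀ c ∈ SS N a b B, ∀ d ∈ SS N a b B, f c < f d → LL N a B d c)
    (f2 : ∀ c ∈ SS N a b B, ∀ d ∈ SS N a b B, f c = f d → c = d)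
    {c d : V} (hcd : Cons N a b B f c d) : (triCompGraph G B (SS N a b B)).Adj c d := by
  have hl := f1 _ hcd.1 _ hcd.2.1 hcd.2.2.1
  have hne : c ≠ d := fun e => (rw_right hl).2 e
  rw [triAdj]
  refine ⟨hne, hcd.1, hcd.2.1, ?_⟩
  by_cases hI : (II N a b B c d).Nonempty
  · exact Or.inr (Or.inl (h.triSep hcd.1 hcd.2.1 hl hI (h.cons_inside f1 f2 hcd)
      (h.cons_third f1 f2 hcd)))
  · left
    rw [Set.not_nonempty_iff_eq_empty] at hI
    obtain ⟨x, hx, hcx⟩ := rw_first (h.mid hcd.1 hcd.2.1 hl subset_rfl h.conn) hne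
    rw [hI] at hx
    rcases hx.2 with hx | hx | hx
    · exact hx.elim
    · exact absurd hx hcx.ne'
    · rw [Set.mem_singleton_iff] at hx
      exact hx ▸ h.NG hcx

theorem adj_cons (h : Ctx G N a b B)
    (f1 : ∀ c ∈ SS N a b B, ∀ d ∈ SS N a b B, f c < f d → LL N a B d c)
    {c d : V} (hcd : (triCompGraph G B (SS N a b B)).Adj c d) (hlt : f c < f d) :
    Cons N a b B f c d ∨ (c = a ∧ d = b) := by
  rw [triAdj] at hcd
  obtain ⟨hne, hc, hd, hor⟩ := hcd
  by_contra! hn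
  obtain ⟨e, he, hce, hed⟩ : ∃ e ∈ SS N a b B, f c < f e ∧ f e < f d := by
    by_contra! hk
    exact hn.1 ⟨hc, hd, hlt, fun e he h1 h2 => absurd h2 (hk e he h1).not_gt⟩
  have hL := f1 _ hc _ he hce
  have hU := h.LtoU he hd (f1 _ he _ hd hed)
  rcases hor with k | k | k
  · have hN : N.Adj c d := by
      refine h.GN _ _ k fun hs => ?_
      rcases Sym2.eq_iff.1 hs with k | k
      · exact hn.2 k.1 k.2
      · have := f1 _ hc _ hd hlt
        exact (rw_left this).2 k.2.symm
    exact excl he (rw_trans hL (rw_adj hN (rw_right hL) (rw_left hU))) hU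
  · exact h.claimA he (Or.inl ⟨hL, hU⟩) k.2
  · exact h.claimA he (Or.inr ⟨hL, hU⟩) k.2

theorem exists_pred [Finite V] (h : Ctx G N a b B)
    (f1 : ∀ c ∈ SS N a b B, ∀ d ∈ SS N a b B, f c < f d → LL N a B d c)
    (f2 : ∀ c ∈ SS N a b B, ∀ d ∈ SS N a b B, f c = f d → c = d)
    {u : V} (hu : u ∈ SS N a b B) (hne : u ≠ a) : ∃ c, Cons N a b B f c u := by
  obtain ⟨c, hc, hmax⟩ := Set.exists_max_image {e | e ∈ SS N a b B ∧ f e < f u} f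
    (Set.toFinite _) ⟨a, h.aS, h.a_min f1 f2 hu hne⟩
  exact ⟨c, hc.1, hu, hc.2, fun e he h1 h2 => absurd h1 (hmax e ⟨he, h2⟩).not_gt⟩

theorem exists_succ [Finite V] (h : Ctx G N a b B)
    (f1 : ∀ c ∈ SS N a b B, ∀ d ∈ SS N a b B, f c < f d → LL N a B d c)
    (f2 : ∀ c ∈ SS N a b B, ∀ d ∈ SS N a b B, f c = f d → c = d)
    {u : V} (hu : u ∈ SS N a b B) (hne : u ≠ b) : ∃ c, Cons N a b B f u c := by
  obtain ⟨c, hc, hmin⟩ := Set.exists_min_image {e | e ∈ SS N a b B ∧ f u < f e} f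
    (Set.toFinite _) ⟨b, h.bS, h.b_max f1 f2 hu hne⟩
  exact ⟨c, hu, hc.1, hc.2, fun e he h1 h2 => absurd h2 (hmin e ⟨he, h1⟩).not_gt⟩

theorem cons_unique_left
    (f2 : ∀ c ∈ SS N a b B, ∀ d ∈ SS N a b B, f c = f d → c = d)
    {u c d : V} (hc : Cons N a b B f c u) (hd : Cons N a b B f d u) : c = d := by
  rcases lt_trichotomy (f c) (f d) with k | k | k
  · exact (hc.2.2.2 d hd.1 k hd.2.2.1).elim
  · exact f2 _ hc.1 _ hd.1 k
  · exact (hd.2.2.2 c hc.1 k hc.2.2.1).elim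

theorem cons_unique_right
    (f2 : ∀ c ∈ SS N a b B, ∀ d ∈ SS N a b B, f c = f d → c = d)
    {u c d : V} (hc : Cons N a b B f u c) (hd : Cons N a b B f u d) : c = d := by
  rcases lt_trichotomy (f c) (f d) with k | k | k
  · exact (hd.2.2.2 c hc.2.1 hc.2.2.1 k).elim
  · exact f2 _ hc.2.1 _ hd.2.1 k
  · exact (hc.2.2.2 d hd.2.1 hd.2.2.1 k).elim

theorem adj_iff (h : Ctx G N a b B)
    (f1 : ∀ c ∈ SS N a b B, ∀ d ∈ SS N a b B, f c < f d → LL N a B d c)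
    (f2 : ∀ c ∈ SS N a b B, ∀ d ∈ SS N a b B, f c = f d → c = d) {c d : V} :
    (triCompGraph G B (SS N a b B)).Adj c d ↔ Cons N a b B f c d ∨ Cons N a b B f d c ∨
      (c = a ∧ d = b) ∨ (c = b ∧ d = a) := by
  constructor
  · intro k
    have k' := triAdj.1 k
    rcases lt_trichotomy (f c) (f d) with l | l | l
    · rcases h.adj_cons f1 k l with m | m
      · exact Or.inl m
      · exact Or.inr (Or.inr (Or.inl m))
    · exact absurd (f2 _ k'.2.1 _ k'.2.2.1 l) k'.1
    · rcases h.adj_cons f1 k.symm l with m | m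
      · exact Or.inr (Or.inl m)
      · exact Or.inr (Or.inr (Or.inr m.symm))
  · have hab : (triCompGraph G B (SS N a b B)).Adj a b :=
      triAdj.2 ⟨h.hab.ne, h.aS, h.bS, Or.inl h.hab⟩
    rintro (k | k | ⟨rfl, rfl⟩ | ⟨rfl, rfl⟩)
    · exact h.cons_adj f1 f2 k
    · exact (h.cons_adj f1 f2 k).symm
    · exact hab
    · exact hab.symm

theorem cycle [Finite V] (h : Ctx G N a b B) :
    IsCycleGraphOn (triCompGraph G B (SS N a b B)) (SS N a b B) := by
  obtain ⟨f, f1, f2⟩ := h.exists_rank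
  obtain ⟨m, hmB, hma, hmb, hmS⟩ := h.third
  have hm : m ∈ SS N a b B := ⟨hmB, hmS⟩
  have hab := h.hab.ne
  refine ⟨⟨⟨a, h.aS⟩, ?_⟩, ?_, Set.toFinite _, ?_⟩
  · have key : ∀ n, ∀ u ∈ SS N a b B, f u = n →
        ReachableWithin (triCompGraph G B (SS N a b B)) (SS N a b B) u a := by
      intro n
      induction n using Nat.strong_induction_on with
      | _ n ih =>
        intro u hu hn
        by_cases hua : u = a
        · subst hua; exact rw_refl hu
        · obtain ⟨c, hc⟩ := h.exists_pred f1 f2 hu hua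
          exact rw_trans (rw_adj (h.cons_adj f1 f2 hc).symm hu hc.1)
            (ih (f c) (hn ▸ hc.2.2.1) c hc.1 rfl)
    exact fun u hu v hv => rw_trans (key _ u hu rfl) (rw_symm (key _ v hv rfl))
  · have : ({a, b, m} : Set V).ncard = 3 :=
      Set.ncard_eq_three.2 ⟨a, b, m, hab, hma.symm, hmb.symm, rfl⟩
    rw [← this]
    refine Set.ncard_le_ncard ?_ (Set.toFinite _)
    rintro x (rfl | rfl | rfl)
    · exact h.aS
    · exact h.bS
    · exact hm
  · have notcons : ∀ c, ¬ Cons N a b B f c a := by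
      intro c hc
      by_cases e : c = a
      · subst e; exact lt_irrefl _ hc.2.2.1
      · exact absurd hc.2.2.1 (h.a_min f1 f2 hc.1 e).not_gt
    have notcons' : ∀ c, ¬ Cons N a b B f b c := by
      intro c hc
      by_cases e : c = b
      · subst e; exact lt_irrefl _ hc.2.2.1
      · exact absurd hc.2.2.1 (h.b_max f1 f2 hc.2.1 e).not_gt
    have notab : ¬ Cons N a b B f a b := fun k =>
      k.2.2.2 m hm (h.a_min f1 f2 hm hma) (h.b_max f1 f2 hm hmb)
    intro v hv
    by_cases hva : v = a
    · subst hva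
      obtain ⟨d, hd⟩ := h.exists_succ f1 f2 hv hab
      refine ⟨d, b, fun e => notab (e ▸ hd), ?_⟩
      ext z
      rw [Set.mem_setOf_eq, h.adj_iff f1 f2]
      constructor
      · rintro (k | k | k | k)
        · exact Or.inl (cons_unique_right f2 k hd)
        · exact (notcons _ k).elim
        · exact Or.inr k.2
        · exact absurd k.1 hab
      · rintro (k | k)
        · exact Or.inl (k ▸ hd)
        · exact Or.inr (Or.inr (Or.inl ⟨rfl, k⟩))
    by_cases hvb : v = b
    · subst hvb
      obtain ⟨d, hd⟩ := h.exists_pred f1 f2 hv hva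
      refine ⟨d, a, fun e => notab (e ▸ hd), ?_⟩
      ext z
      rw [Set.mem_setOf_eq, h.adj_iff f1 f2]
      constructor
      · rintro (k | k | k | k)
        · exact (notcons' _ k).elim
        · exact Or.inl (cons_unique_left f2 k hd)
        · exact absurd k.1 hva
        · exact Or.inr k.2
      · rintro (k | k)
        · exact Or.inr (Or.inl (k ▸ hd))
        · exact Or.inr (Or.inr (Or.inr ⟨rfl, k⟩))
    · obtain ⟨c, hc⟩ := h.exists_pred f1 f2 hv hva
      obtain ⟨d, hd⟩ := h.exists_succ f1 f2 hv hvb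
      refine ⟨c, d, fun e => ?_, ?_⟩
      · subst e
        exact absurd hc.2.2.1 hd.2.2.1.not_gt
      ext z
      rw [Set.mem_setOf_eq, h.adj_iff f1 f2]
      constructor
      · rintro (k | k | k | k)
        · exact Or.inr (cons_unique_right f2 k hd)
        · exact Or.inl (cons_unique_left f2 k hc)
        · exact absurd k.1 hva
        · exact absurd k.1 hvb
      · rintro (k | k)
        · exact Or.inr (Or.inl (k ▸ hc))
        · exact Or.inl (k ▸ hd)

theorem triComp [Finite V] (h : Ctx G N a b B) : IsTriCompOn G B (SS N a b B) := by
  obtain ⟨f, f1, f2⟩ := h.exists_rank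
  refine ⟨fun x hx => hx.1, ?_, ?_⟩
  · intro u hu v hv hne
    exact ⟨hu.1, hv.1, fun s t hst => h.noSep hu hv hne hst.2⟩
  · intro R hSR hRB hR
    refine Set.Subset.antisymm ?_ hSR
    intro v hvR
    by_contra hvS
    have hvB := hRB hvR
    have hside : ∀ e ∈ SS N a b B, LL N a B e v ∨ UU N b B e v := fun e he =>
      h.side e he.1 v hvB fun k => hvS (k ▸ he)
    have hUa : UU N b B a v := by
      rcases hside a h.aS with k | k
      · exact absurd rfl (rw_left k).2
      · exact k
    have hLb : LL N a B b v := by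
      rcases hside b h.bS with k | k
      · exact k
      · exact absurd rfl (rw_right k).2
    obtain ⟨c, hc, hcmax⟩ := Set.exists_max_image {e | e ∈ SS N a b B ∧ UU N b B e v} f
      (Set.toFinite _) ⟨a, h.aS, hUa⟩
    obtain ⟨d, hd, hdmin⟩ := Set.exists_min_image {e | e ∈ SS N a b B ∧ LL N a B e v} f
      (Set.toFinite _) ⟨b, h.bS, hLb⟩
    have hlt : f c < f d := by
      rcases lt_trichotomy (f c) (f d) with k | k | k
      · exact k
      · have := f2 _ hc.1 _ hd.1 k
        subst this
        exact (excl hc.1 hd.2 hc.2).elim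
      · exact (excl hc.1 (h.monoL hd.1 hc.1 (f1 _ hd.1 _ hc.1 k) hd.2) hc.2).elim
    have hcons : Cons N a b B f c d := by
      refine ⟨hc.1, hd.1, hlt, fun e he h1 h2 => ?_⟩
      rcases hside e he with k | k
      · exact absurd h2 (hdmin e ⟨he, k⟩).not_gt
      · exact absurd h1 (hcmax e ⟨he, k⟩).not_gt
    have hvI : v ∈ II N a b B c d := ⟨hc.2, hd.2⟩
    have hin := h.cons_inside f1 f2 hcons
    obtain ⟨e, he, hec, hed⟩ := h.cons_third f1 f2 hcons
    have htri := h.triSep hc.1 hd.1 (f1 _ hc.1 _ hd.1 hlt) ⟨v, hvI⟩ hin ⟨e, he, hec, hed⟩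
    have hve : v ≠ e := fun k => hvS (k ▸ he)
    have hvc : v ≠ c := fun k => hvS (k ▸ hc.1)
    have hvd : v ≠ d := fun k => hvS (k ▸ hd.1)
    exact (hR hvR (hSR he) hve).2.2 c d htri ⟨⟨hvB, by simp [hvc, hvd]⟩,
      ⟨he.1, by simp [hec, hed]⟩, h.sep hc.1 hd.1 hvI fun k => hin e k he⟩

end Ctx

theorem side_aux {G N : SimpleGraph V} {a b : V} {A : Set V}
    (GN : ∀ u v, G.Adj u v → s(u, v) ≠ s(a, b) → N.Adj u v) {v x : V}
    (hx : x = a ∨ x = b) (hr : ReachableWithin G A v x) :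
    ReachableWithin N A a v ∨ ReachableWithin N A v b := by
  obtain ⟨p, hp⟩ := hr
  induction p with
  | @nil u =>
    have hu : u ∈ A := hp u (by simp)
    rcases hx with rfl | rfl
    · exact Or.inl (rw_refl hu)
    · exact Or.inr (rw_refl hu)
  | @cons u w x huw p ih =>
    have hu : u ∈ A := hp u (by simp)
    have hw : w ∈ A := hp w (by simp)
    by_cases hs : s(u, w) = s(a, b)
    · rcases Sym2.eq_iff.1 hs with ⟨rfl, -⟩ | ⟨rfl, -⟩
      · exact Or.inl (rw_refl hu)
      · exact Or.inr (rw_refl hu)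
    · have hN := GN _ _ huw hs
      rcases ih hx (fun y hy => hp y (by simp [hy])) with k | k
      · exact Or.inl (rw_trans k (rw_adj hN.symm hw hu))
      · exact Or.inr (rw_trans (rw_adj hN hu hw) k)

/-- A path between two distinct vertices of a block stays in the block. -/
theorem block_path {G : SimpleGraph V} {a b : V} {B : Set V} (hB : IsBlock G B)
    (ha : a ∈ B) (hb : b ∈ B) (hab : a ≠ b) (p : G.Walk a b) (hp : p.IsPath) :
    ∀ x ∈ p.support, x ∈ B := by
  have key : BiconnectedOn G (B ∪ {x | x ∈ p.support}) := by
    -- deleting a (possibly outside) vertex `w`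
    have main : ∀ (D : Set V) (t : V), t ∈ B → t ∈ D →
        (∀ u ∈ B ∩ D, ReachableWithin G (B ∩ D) u t) →
        (∀ x ∈ p.support, x ∈ D →
          ReachableWithin G ({x | x ∈ p.support} ∩ D) a x ∨
          ReachableWithin G ({x | x ∈ p.support} ∩ D) x b) →
        ConnectedOn G ((B ∪ {x | x ∈ p.support}) ∩ D) := by
      intro D t ht htD h1 h2
      have s1 : B ∩ D ⊆ (B ∪ {x | x ∈ p.support}) ∩ D := fun x hx => ⟨Or.inl hx.1, hx.2⟩
      have s2 : {x | x ∈ p.support} ∩ D ⊆ (B ∪ {x | x ∈ p.support}) ∩ D :=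
        fun x hx => ⟨Or.inr hx.1, hx.2⟩
      have all : ∀ u ∈ (B ∪ {x | x ∈ p.support}) ∩ D,
          ReachableWithin G ((B ∪ {x | x ∈ p.support}) ∩ D) u t := by
        rintro u ⟨hu | hu, huD⟩
        · exact rw_mono s1 (h1 u ⟨hu, huD⟩)
        · rcases h2 u hu huD with k | k
          · exact rw_trans (rw_symm (rw_mono s2 k)) (rw_mono s1 (h1 a ⟨ha, (rw_left k).2⟩))
          · exact rw_trans (rw_mono s2 k) (rw_mono s1 (h1 b ⟨hb, (rw_right k).2⟩))
      exact ⟨⟨t, Or.inl ht, htD⟩, fun u hu v hv => rw_trans (all u hu) (rw_symm (all v hv))⟩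
    constructor
    · have := main Set.univ a ha trivial
        (fun u hu => by simpa using hB.1.1.2 hu.1 ha)
        (fun x hx _ => by
          obtain ⟨q, r, -, -, hq, -⟩ := split_path p hp hx
          exact Or.inl ⟨q, fun y hy => ⟨hq y hy, trivial⟩⟩)
      simpa using this
    · intro w hw _
      obtain ⟨t, ht, htw⟩ : ∃ t ∈ B, t ≠ w := by
        by_cases k : a = w
        · exact ⟨b, hb, fun e => hab (k.trans e.symm)⟩
        · exact ⟨a, ha, k⟩
      have := main {w}ᶜ t ht htw ?_ ?_
      · simpa [Set.sdiff_eq] using this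
      · intro u hu
        rw [← Set.sdiff_eq] at hu ⊢
        by_cases hwB : w ∈ B
        · exact (hB.1.2 w hwB ⟨t, ht, htw⟩).2 hu ⟨ht, htw⟩
        · have : B \ {w} = B := Set.sdiff_singleton_eq_self hwB
          rw [this]
          exact hB.1.1.2 hu.1 ht
      · intro x hx hxw
        obtain ⟨q, r, -, -, hq, hr, hqr, -⟩ := split_path p hp hx
        by_cases hwq : w ∈ q.support
        · right
          refine ⟨r, fun y hy => ⟨hr y hy, ?_⟩⟩
          rintro rfl
          exact hxw (hqr _ hwq hy).symm
        · left
          refine ⟨q, fun y hy => ⟨hq y hy, ?_⟩⟩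
          rintro rfl
          exact hwq hy
  have := hB.2 _ Set.subset_union_left key
  intro x hx
  rw [← this]
  exact Or.inr hx

theorem exists_block [Finite V] {G : SimpleGraph V} {A : Set V} (hA : BiconnectedOn G A) :
    ∃ B, A ⊆ B ∧ IsBlock G B := by
  obtain ⟨B, hB, hmax⟩ := Set.exists_max_image {B | A ⊆ B ∧ BiconnectedOn G B} Set.ncard
    (Set.toFinite _) ⟨A, subset_rfl, hA⟩
  refine ⟨B, hB.1, hB.2, fun B' hBB' hB' => ?_⟩
  exact (Set.eq_of_subset_of_ncard_le hBB' (hmax B' ⟨hB.1.trans hBB', hB'⟩) (Set.toFinite _)).symm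

theorem mkCtx [Finite V] (G : SimpleGraph V)
    (a b : V) (hadj : G.Adj a b)
    (B : Set V) (hB : IsBlock G B) (ha : a ∈ B) (hb : b ∈ B)
    (hconn : (G.deleteEdges {s(a, b)}).Reachable a b)
    (hblk : ¬ ∃ B' : Set V, IsBlock (G.deleteEdges {s(a, b)}) B' ∧ a ∈ B' ∧ b ∈ B') :
    Ctx G (G.deleteEdges {s(a, b)}) a b B := by
  classical
  have NG : G.deleteEdges {s(a, b)} ≤ G := G.deleteEdges_le _
  have GN : ∀ u v, G.Adj u v → s(u, v) ≠ s(a, b) → (G.deleteEdges {s(a, b)}).Adj u v := by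
    intro u v h1 h2
    rw [SimpleGraph.deleteEdges_adj]
    exact ⟨h1, h2⟩
  generalize G.deleteEdges {s(a, b)} = N at *
  have hne := hadj.ne
  have conn : ReachableWithin N B a b := by
    obtain ⟨p⟩ := hconn
    refine ⟨p.bypass, fun x hx => ?_⟩
    exact block_path hB ha hb hne (p.bypass.mapLe NG) (by simpa using p.bypass_isPath) x
      (by simpa using hx)
  have side : ∀ w ∈ B, ∀ v ∈ B, v ≠ w →
      ReachableWithin N (B \ {w}) a v ∨ ReachableWithin N (B \ {w}) v b := by
    intro w hw v hv hvw
    have hc := hB.1.2 w hw ⟨v, hv, hvw⟩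
    by_cases k : a = w
    · exact side_aux GN (Or.inr rfl) (hc.2 ⟨hv, hvw⟩ ⟨hb, fun e => hne (k.trans e.symm)⟩)
    · exact side_aux GN (Or.inl rfl) (hc.2 ⟨hv, hvw⟩ ⟨ha, k⟩)
  refine ⟨ha, hb, hadj, NG, GN, conn, side, ?_⟩
  by_contra! hn
  apply hblk
  have hbi : BiconnectedOn N B := by
    constructor
    · have all : ∀ u ∈ B, ReachableWithin N B u a := by
        intro u hu
        rcases side_aux GN (Or.inl rfl) (hB.1.1.2 hu ha) with k | k
        · exact rw_symm k
        · exact rw_trans k (rw_symm conn)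
      exact ⟨⟨a, ha⟩, fun u hu v hv => rw_trans (all u hu) (rw_symm (all v hv))⟩
    · intro w hw hne'
      refine ⟨hne', ?_⟩
      by_cases hwa : w = a
      · have all : ∀ u ∈ B \ {w}, ReachableWithin N (B \ {w}) u b := by
          intro u hu
          rcases side w hw u hu.1 hu.2 with k | k
          · exact absurd hwa.symm (rw_left k).2
          · exact k
        exact fun u hu v hv => rw_trans (all u hu) (rw_symm (all v hv))
      by_cases hwb : w = b
      · have all : ∀ u ∈ B \ {w}, ReachableWithin N (B \ {w}) u a := by
          intro u hu
          rcases side w hw u hu.1 hu.2 with k | k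
          · exact rw_symm k
          · exact absurd hwb.symm (rw_right k).2
        exact fun u hu v hv => rw_trans (all u hu) (rw_symm (all v hv))
      · have hab := hn w hw hwa hwb
        have all : ∀ u ∈ B \ {w}, ReachableWithin N (B \ {w}) u a := by
          intro u hu
          rcases side w hw u hu.1 hu.2 with k | k
          · exact rw_symm k
          · exact rw_trans k (rw_symm hab)
        exact fun u hu v hv => rw_trans (all u hu) (rw_symm (all v hv))
  obtain ⟨B', hBB', hB'⟩ := exists_block hbi
  exact ⟨B', hB', hBB' ha, hBB' hb⟩

end SN

/-- If the endpoints of the edge `{a,b}` lie in a common block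
`Bab` of `G`, and in `G − {a,b}` they lie in the same connected component but in no
common block, then the edge `{a,b}` belongs to a cycle component (S-node) of the
triconnected decomposition of `Bab`. -/
theorem stmt11 {V : Type*} [Fintype V] (G : SimpleGraph V)
    (a b : V) (hadj : G.Adj a b)
    (Bab : Set V) (hB : IsBlock G Bab) (ha : a ∈ Bab) (hb : b ∈ Bab)
    (hconn : (G.deleteEdges {s(a, b)}).Reachable a b)
    (hblk : ¬ ∃ B' : Set V, IsBlock (G.deleteEdges {s(a, b)}) B' ∧ a ∈ B' ∧ b ∈ B') :
    ∃ S : Set V,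
      IsTriCompOn G Bab S ∧
      IsCycleGraphOn (triCompGraph G Bab S) S ∧
      a ∈ S ∧ b ∈ S := by
  have h := SN.mkCtx G a b hadj Bab hB ha hb hconn hblk
  exact ⟨_, h.triComp, h.cycle, h.aS, h.bS⟩
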